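/- arXiv:1506.02680 — 2 statements merged into one kernel-verified Lean document; each statement's English description precedes it below -/
import Mathlib

section
/- Let A be an associative ℂ-algebra, let n ≥ 1, let z_1,…,z_n ∈ ℂ, and let H_1,…,H_n, F_1,…,F_n ∈ A satisfy H_iF_i − F_iH_i = −2F_i for each i, and H_iF_j = F_jH_i whenever i ≠ j. For t ∈ ℂ \ {z_1,…,z_n} set Z(t) = Σ_{i=1}^n (t − z_i)^{−1} H_i and Y(t) = Σ_{i=1}^n (t − z_i)^{−1} F_i. Then for all t_a, t_b ∈ ℂ \ {z_1,…,z_n} with t_a ≠ t_b: Z(t_a)Y(t_b) − Y(t_b)Z(t_a) = (2/(t_a − t_b))·(Y(t_a) − Y(t_b)). -/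
/-- the commutation relation `[Z(t_a), Y(t_b)] = (2/(t_a−t_b))(Y(t_a) − Y(t_b))`
for `Z(t) = Σ_i (t−z_i)⁻¹ H_i` and `Y(t) = Σ_i (t−z_i)⁻¹ F_i`, given `[H_i, F_i] = −2F_i`
and that operators with distinct indices commute. -/
theorem stmt_7 (A : Type*) [Ring A] [Algebra ℂ A]
    (n : ℕ) (hn : 1 ≤ n) (z : Fin n → ℂ) (H F : Fin n → A)
    (hHF : ∀ i : Fin n, H i * F i - F i * H i = (-2 : ℂ) • F i)
    (hHFcomm : ∀ i j : Fin n, i ≠ j → H i * F j = F j * H i)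
    (Z Y : ℂ → A)
    (hZ : ∀ t : ℂ, Z t = ∑ i : Fin n, (t - z i)⁻¹ • H i)
    (hY : ∀ t : ℂ, Y t = ∑ i : Fin n, (t - z i)⁻¹ • F i)
    (ta tb : ℂ) (hta : ∀ i : Fin n, ta ≠ z i) (htb : ∀ i : Fin n, tb ≠ z i)
    (htab : ta ≠ tb) :
    Z ta * Y tb - Y tb * Z ta = (2 / (ta - tb)) • (Y ta - Y tb) := by
  have hcomm : ∀ i j : Fin n,
      H i * F j - F j * H i = if i = j then (-2 : ℂ) • F i else 0 := by
    intro i j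
    split_ifs with h
    · subst h
      exact hHF i
    · exact sub_eq_zero.mpr (hHFcomm i j h)
  have hexpand : Z ta * Y tb - Y tb * Z ta =
      ∑ i, ∑ j, ((ta - z i)⁻¹ * (tb - z j)⁻¹) • (H i * F j - F j * H i) := by
    rw [hZ, hY, Finset.sum_mul_sum, Finset.sum_mul_sum,
      Finset.sum_comm (f := fun i j => (tb - z i)⁻¹ • F i * (ta - z j)⁻¹ • H j)]
    simp only [← Finset.sum_sub_distrib, smul_mul_smul_comm, smul_sub]
    simp only [mul_comm]
  rw [hexpand, hY, hY, ← Finset.sum_sub_distrib, Finset.smul_sum]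
  refine Finset.sum_congr rfl fun i _ => ?_
  simp only [hcomm, smul_ite, smul_zero, Finset.sum_ite_eq, Finset.mem_univ, if_true]
  rw [← sub_smul, smul_smul, smul_smul]
  congr 1
  have ha := sub_ne_zero.mpr (hta i)
  have hb := sub_ne_zero.mpr (htb i)
  have hab := sub_ne_zero.mpr htab
  field_simp
  ring
end

section
/- Let λ_1 > 0 > λ_2 be reals with λ_1 ∉ ℤ, λ := λ_1 + λ_2 > 0 and λ ∉ ℤ. With d defined as below for the generic pair (λ_1, λ_2), for every k ∈ ℕ: d(k) = (−1)^k if 0 ≤ k ≤ ⌊λ/2⌋; d(k) = (−1)^{⌈λ/2⌉} if ⌈λ/2⌉ ≤ k ≤ ⌊(λ+1)/2⌋; d(k) = (−1)^{⌈λ/2⌉ + ⌈(λ+1)/2⌉ + k} if ⌈(λ+1)/2⌉ ≤ k ≤ ⌈λ⌉; d(k) = 1 if ⌈λ⌉ + 1 ≤ k ≤ ⌈λ_1⌉; and d(k) = (−1)^{⌈λ_1⌉ + k} if k ≥ ⌈λ_1⌉ + 1. In particular every multiplicity space in M_{λ_1} ⊗ M_{λ_2} is definite. -/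
open scoped Classical

/-- `fsig λ k` is the coefficient of `e^{λ-2k}` in the signature character of the
Verma module `M_λ` evaluated at `s = -1`. -/
noncomputable def fsig (lam : ℝ) (k : ℤ) : ℤ :=
  if k < 0 then 0
  else if lam < 0 then (-1) ^ k.toNat
  else if k ≤ ⌊lam⌋ then 1
  else (-1) ^ (k + ⌈lam⌉).toNat

/-- `convSig n lam k = Σ_{k₁+⋯+k_n = k} ∏_i f_{λ_i}(k_i)`, the coefficient of
`e^{λ−2k}` in the product of signature characters at `s = −1`. -/
noncomputable def convSig (n : ℕ) (lam : Fin n → ℝ) (k : ℕ) : ℤ :=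
  ∑ x ∈ Finset.Nat.antidiagonalTuple n k, ∏ i, fsig (lam i) (x i)

/-- The sign `(-1) ^ n` in a form accessible to linear arithmetic. -/
def paritySign (n : ℤ) : ℤ := 1 - 2 * (n % 2)

lemma neg_one_pow_eq_paritySign (n : ℕ) : (-1 : ℤ) ^ n = paritySign n := by
  unfold paritySign
  rcases Nat.even_or_odd n with h | h
  · rw [h.neg_one_pow]
    obtain ⟨r, rfl⟩ := h
    omega
  · rw [h.neg_one_pow]
    obtain ⟨r, rfl⟩ := h
    omega

lemma paritySign_add (m n : ℤ) : paritySign (m + n) = paritySign m * paritySign n := by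
  unfold paritySign
  rcases Int.emod_two_eq_zero_or_one m with h | h <;>
    rcases Int.emod_two_eq_zero_or_one n with h' | h' <;>
    rw [h, h'] <;> omega

lemma paritySign_congr {m n : ℤ} (h : m % 2 = n % 2) : paritySign m = paritySign n := by
  simp only [paritySign, h]

lemma paritySign_mul_self (n : ℤ) : paritySign n * paritySign n = 1 := by
  rw [← paritySign_add]
  unfold paritySign
  omega

lemma floor_eq_ceil_sub_one {x : ℝ} (hx : ∀ n : ℤ, x ≠ n) : ⌊x⌋ = ⌈x⌉ - 1 := by
  rw [Int.floor_eq_iff]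
  have h := Int.ceil_lt_add_one x
  have h' := lt_of_le_of_ne (Int.le_ceil x) (hx _)
  push_cast
  constructor <;> linarith

lemma fsig_eq {x : ℝ} (hx : ∀ n : ℤ, x ≠ n) (j : ℕ) :
    fsig x j = if ⌈x⌉ ≤ 0 then paritySign j
      else if (j : ℤ) < ⌈x⌉ then 1 else paritySign (j + ⌈x⌉) := by
  have h0 : x < 0 ↔ ⌈x⌉ ≤ 0 := by
    rw [Int.ceil_le]
    have := hx 0
    push_cast at this ⊢
    exact ⟨le_of_lt, fun h => lt_of_le_of_ne h this⟩
  have h1 : ¬ ((j : ℤ) < 0) := by omega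
  unfold fsig
  rw [if_neg h1]
  simp only [h0, floor_eq_ceil_sub_one hx, neg_one_pow_eq_paritySign]
  split_ifs <;> first | rfl | (apply paritySign_congr; omega) | omega

lemma fsig_of_neg {x : ℝ} (hx : x < 0) (j : ℕ) : fsig x j = paritySign j := by
  have h1 : ¬ ((j : ℤ) < 0) := by omega
  unfold fsig
  rw [if_neg h1, if_pos hx, neg_one_pow_eq_paritySign]
  simp

/-- The signature of the level-`m` multiplicity space, in terms of `a = ⌈λ₁⌉` and
`c = ⌈λ₁ + λ₂⌉`. -/
def multSig (a c m : ℕ) : ℤ :=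
  if 2 * m ≤ c then paritySign m
  else if m ≤ c then paritySign (m + c + 1)
  else if m ≤ a then 1
  else paritySign (m + a)

/-- Sums of a sequence alternating up to index `c` and constant afterwards. -/
lemma sum_truncated_alternating (k c n : ℕ) :
    ∑ m ∈ Finset.range n, (if k + m < c then paritySign (k + m) else paritySign c) =
      (if min n (c - k) % 2 = 1 then paritySign k else 0) +
        paritySign c * ((n : ℤ) - (min n (c - k) : ℕ)) := by
  induction n with
  | zero => simp
  | succ n ih =>
    rw [Finset.sum_range_succ, ih]
    by_cases h : k + n < c
    · have e1 : min n (c - k) = n := by omega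
      have e2 : min (n + 1) (c - k) = n + 1 := by omega
      rw [e1, e2, if_pos h]
      unfold paritySign
      simp only [sub_self, mul_zero]
      split_ifs <;> omega
    · have e1 : min n (c - k) = c - k := by omega
      have e2 : min (n + 1) (c - k) = c - k := by omega
      rw [e1, e2, if_neg h]
      push_cast
      ring

lemma sum_truncated_alternating_restricted (k c n : ℕ) :
    ∑ m ∈ Finset.range n,
        (if 2 * m < c then (if k + m < c then paritySign (k + m) else paritySign c) else 0) =
      (if min (min n ((c + 1) / 2)) (c - k) % 2 = 1 then paritySign k else 0) +
        paritySign c * ((min n ((c + 1) / 2) : ℕ) -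
          (min (min n ((c + 1) / 2)) (c - k) : ℕ)) := by
  rw [← sum_truncated_alternating, ← Finset.sum_filter]
  congr 1
  ext m
  simp only [Finset.mem_filter, Finset.mem_range]
  omega

lemma sum_multSig_tail (a c n : ℕ) (hac : c ≤ a) (hc : 0 < c) :
    ∑ m ∈ Finset.range (n + 1), (if 2 * m < c then 0 else paritySign m * multSig a c m) =
      if 2 * n < c then 0
      else if n ≤ c then
        (if c % 2 = 1 then (n : ℤ) + 1 - ((c + 1) / 2 : ℕ) else 1 - (n - (c / 2 : ℕ)))
      else if n < a then
        (if c % 2 = 1 then (((c + 1) / 2 : ℕ) : ℤ) else -((c / 2 : ℕ) : ℤ)) + ((n + 1) % 2 : ℕ)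
      else
        (if c % 2 = 1 then (((c + 1) / 2 : ℕ) : ℤ) else -((c / 2 : ℕ) : ℤ)) + (a % 2 : ℕ) +
          (if a % 2 = 1 then -1 else 1) * ((n : ℤ) - a + 1) := by
  have hterm (m : ℕ) : paritySign m * multSig a c m =
      if 2 * m ≤ c then 1
      else if m ≤ c then paritySign (c + 1)
      else if m ≤ a then paritySign m
      else paritySign a := by
    unfold multSig
    split_ifs <;> simp only [paritySign_mul_self, mul_one, ← paritySign_add] <;>
      (apply paritySign_congr; omega)
  simp only [hterm]
  induction n with
  | zero => simp [hc]
  | succ n ih =>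
    rw [Finset.sum_range_succ, ih]
    unfold paritySign
    clear ih hterm
    rcases Nat.mod_two_eq_zero_or_one c with h | h <;>
    rcases Nat.mod_two_eq_zero_or_one a with h' | h' <;>
    simp only [h, h'] <;> split_ifs <;> first | contradiction | omega

set_option maxHeartbeats 1000000 in
lemma sum_multSig_eq (a c k : ℕ) (hac : c ≤ a) (hc : 0 < c) :
    ∑ m ∈ Finset.range (k + 1), multSig a c m *
        (if c ≤ 2 * m then paritySign (k + m)
          else if k + m < c then 1 else paritySign (k + m + c)) =
      ∑ m ∈ Finset.range (k + 1),
        (if m < a then paritySign (k + m) else paritySign (k + a)) := by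
  have hl : ∀ m ∈ Finset.range (k + 1), multSig a c m *
        (if c ≤ 2 * m then paritySign (k + m)
          else if k + m < c then 1 else paritySign (k + m + c)) = paritySign k *
      ((if 2 * m < c then (if k + m < c then paritySign (k + m) else paritySign c) else 0) +
        (if 2 * m < c then 0 else paritySign m * multSig a c m)) := by
    intro m _
    by_cases h : 2 * m < c
    · have e : multSig a c m = paritySign m := by
        unfold multSig
        rw [if_pos h.le]
      rw [if_neg (by omega), e, if_pos h, if_pos h, add_zero]
      split_ifs <;> simp only [mul_one, ← paritySign_add] <;>
        (apply paritySign_congr; omega)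
    · rw [if_pos (by omega), if_neg h, if_neg h, zero_add, paritySign_add]
      ring
  have hr : ∀ m ∈ Finset.range (k + 1),
      (if m < a then paritySign (k + m) else paritySign (k + a)) = paritySign k *
        (if 0 + m < a then paritySign ((0 : ℕ) + m) else paritySign a) := by
    intro m _
    simp only [paritySign_add, zero_add, Nat.cast_zero]
    split_ifs <;> rfl
  rw [Finset.sum_congr rfl hl, Finset.sum_congr rfl hr, ← Finset.mul_sum, ← Finset.mul_sum,
    Finset.sum_add_distrib, sum_truncated_alternating_restricted, sum_multSig_tail a c k hac hc,
    sum_truncated_alternating]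
  congr 1
  have hs (n : ℕ) : paritySign n = if n % 2 = 1 then -1 else 1 := by
    unfold paritySign
    split_ifs <;> omega
  simp only [hs]
  rcases Nat.mod_two_eq_zero_or_one c with h | h <;>
    rcases Nat.mod_two_eq_zero_or_one a with h' | h' <;>
    simp only [h, h'] <;> split_ifs <;> first | contradiction | omega

lemma convSig_two_eq {x y : ℝ} (hx : ∀ n : ℤ, x ≠ n) (hy : y < 0) (a k : ℕ) (ha : ⌈x⌉ = a)
    (ha0 : 0 < a) :
    convSig 2 ![x, y] k = ∑ m ∈ Finset.range (k + 1),
        (if m < a then paritySign (k + m) else paritySign (k + a)) := by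
  unfold convSig
  rw [Finset.Nat.antidiagonalTuple_two, Finset.sum_map,
    Finset.Nat.sum_antidiagonal_eq_sum_range_succ_mk]
  refine Finset.sum_congr rfl fun m hm => ?_
  rw [Finset.mem_range] at hm
  simp only [Fin.prod_univ_two, piFinTwoEquiv, Equiv.toEmbedding, Function.Embedding.coeFn_mk,
    Equiv.coe_fn_symm_mk, Fin.cons_zero, Fin.cons_one, Matrix.cons_val_zero, Matrix.cons_val_one]
  rw [fsig_eq hx, fsig_of_neg hy, ha, if_neg (by omega)]
  split_ifs <;> (try omega) <;> simp only [one_mul, ← paritySign_add] <;>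
    (apply paritySign_congr; omega)

/-- the multiplicity space signatures for a generic pair
`λ₁ > 0 > λ₂` with `λ := λ₁ + λ₂ > 0`; in particular every multiplicity space in
`M_{λ₁} ⊗ M_{λ₂}` is definite. -/
theorem stmt_13 (lam₁ lam₂ : ℝ) (h1 : lam₁ > 0) (h2 : 0 > lam₂)
    (hl1 : ∀ n : ℤ, lam₁ ≠ n) (hsum : lam₁ + lam₂ > 0)
    (hsumZ : ∀ n : ℤ, lam₁ + lam₂ ≠ n)
    (d : ℕ → ℤ)
    (hd : ∀ k : ℕ, d k = convSig 2 ![lam₁, lam₂] k -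
      ∑ m ∈ Finset.range k, d m * fsig ((lam₁ + lam₂) - 2 * m) ((k : ℤ) - m)) :
    ∀ k : ℕ,
      ((k : ℤ) ≤ ⌊(lam₁ + lam₂) / 2⌋ → d k = (-1) ^ k) ∧
      (⌈(lam₁ + lam₂) / 2⌉ ≤ (k : ℤ) → (k : ℤ) ≤ ⌊(lam₁ + lam₂ + 1) / 2⌋ →
        d k = (-1) ^ (⌈(lam₁ + lam₂) / 2⌉.toNat)) ∧
      (⌈(lam₁ + lam₂ + 1) / 2⌉ ≤ (k : ℤ) → (k : ℤ) ≤ ⌈lam₁ + lam₂⌉ →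
        d k = (-1) ^ ((⌈(lam₁ + lam₂) / 2⌉ + ⌈(lam₁ + lam₂ + 1) / 2⌉ + k).toNat)) ∧
      (⌈lam₁ + lam₂⌉ + 1 ≤ (k : ℤ) → (k : ℤ) ≤ ⌈lam₁⌉ → d k = 1) ∧
      (⌈lam₁⌉ + 1 ≤ (k : ℤ) → d k = (-1) ^ ((⌈lam₁⌉ + k).toNat)) ∧
      (d k).natAbs = 1 := by
  have hlam0 := Int.ceil_pos.2 hsum
  have hlam₁0 := Int.ceil_pos.2 h1
  have hle : ⌈lam₁ + lam₂⌉ ≤ ⌈lam₁⌉ := Int.ceil_mono (by linarith)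
  obtain ⟨a, ha⟩ := Int.eq_ofNat_of_zero_le hlam₁0.le
  obtain ⟨c, hc⟩ := Int.eq_ofNat_of_zero_le hlam0.le
  have hac : c ≤ a := by omega
  have hc0 : 0 < c := by omega
  have hfsig (k m : ℕ) (hm : m ≤ k) : fsig ((lam₁ + lam₂) - 2 * m) ((k : ℤ) - m) =
      if c ≤ 2 * m then paritySign (k + m)
        else if k + m < c then 1 else paritySign (k + m + c) := by
    have hx (n : ℤ) : (lam₁ + lam₂) - 2 * m ≠ n := by
      intro h
      apply hsumZ (n + 2 * m)
      push_cast
      linarith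
    have hceil : ⌈(lam₁ + lam₂) - 2 * m⌉ = c - 2 * m := by
      rw [← hc]
      exact_mod_cast Int.ceil_sub_intCast (lam₁ + lam₂) (2 * m)
    rw [← Nat.cast_sub hm, fsig_eq hx, hceil]
    split_ifs <;> first | omega | rfl | (apply paritySign_congr; omega)
  have hd_eq (k : ℕ) : d k = multSig a c k := by
    induction k using Nat.strong_induction_on with
    | _ k ih =>
      have hsum' := sum_multSig_eq a c k hac hc0
      rw [← convSig_two_eq hl1 h2 a k ha (by omega), Finset.sum_range_succ] at hsum'
      rw [hd, ← hsum', ← hfsig k k le_rfl]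
      have hdiag : fsig ((lam₁ + lam₂) - 2 * k) ((k : ℤ) - k) = 1 := by
        rw [hfsig k k le_rfl]
        unfold paritySign
        split_ifs <;> omega
      rw [hdiag, mul_one]
      have hlow : ∑ m ∈ Finset.range k, d m * fsig ((lam₁ + lam₂) - 2 * m) ((k : ℤ) - m) =
          ∑ m ∈ Finset.range k, multSig a c m * (if c ≤ 2 * m then paritySign (k + m)
            else if k + m < c then 1 else paritySign (k + m + c)) := by
        refine Finset.sum_congr rfl fun m hm => ?_
        rw [Finset.mem_range] at hm
        rw [ih m hm, hfsig k m hm.le]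
      rw [hlow]
      ring
  have hhalf (n : ℤ) : ⌈(lam₁ + lam₂) / 2⌉ ≤ n ↔ (c : ℤ) ≤ 2 * n := by
    rw [← hc, Int.ceil_le, Int.ceil_le, div_le_iff₀ two_pos]
    push_cast
    rw [mul_comm]
  have hhalf' (n : ℤ) : ⌈(lam₁ + lam₂ + 1) / 2⌉ ≤ n ↔ (c : ℤ) + 1 ≤ 2 * n := by
    rw [← hc, ← Int.ceil_add_one, Int.ceil_le, Int.ceil_le, div_le_iff₀ two_pos]
    push_cast
    rw [mul_comm]
  have hfl := floor_eq_ceil_sub_one (x := (lam₁ + lam₂) / 2) fun n h =>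
    hsumZ (2 * n) (by push_cast; linarith)
  have hfl' := floor_eq_ceil_sub_one (x := (lam₁ + lam₂ + 1) / 2) fun n h =>
    hsumZ (2 * n - 1) (by push_cast; linarith)
  have hp : ⌈(lam₁ + lam₂) / 2⌉ = ((c : ℤ) + 1) / 2 := by
    have := (hhalf (((c : ℤ) + 1) / 2)).2 (by omega)
    have := (hhalf _).1 le_rfl
    omega
  have hq : ⌈(lam₁ + lam₂ + 1) / 2⌉ = ((c : ℤ) + 2) / 2 := by
    have := (hhalf' (((c : ℤ) + 2) / 2)).2 (by omega)
    have := (hhalf' _).1 le_rfl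
    omega
  intro k
  rw [hd_eq k, hfl, hfl', hp, hq, hc, ha]
  have hpq : ((c : ℤ) + 1) / 2 + ((c : ℤ) + 2) / 2 = c + 1 := by omega
  simp only [neg_one_pow_eq_paritySign, hpq]
  unfold multSig paritySign
  refine ⟨?_, ?_, ?_, ?_, ?_, ?_⟩ <;> intros <;> split_ifs <;> omega
end
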